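/- arXiv:1004.1700 — 2 statements merged into one kernel-verified Lean document; each statement's English description precedes it below -/
import Mathlib

section
/- For every integer k ≥ 1, the bilinear alternating map Φ_k defined on sl(2) × sl(2) by Φ_k(g d/dx, h d/dx)(f dx^{(1−k)/2}) = (g′h″ − g″h′) f^{(k−1)} dx^{(1+k)/2} is a 2-cocycle of sl(2) with values in D_{(1−k)/2,(1+k)/2}: for all polynomials g, h, l of degree ≤ 2, L^{λ,μ}_X(Φ_k(Y,Z)) − L^{λ,μ}_Y(Φ_k(X,Z)) + L^{λ,μ}_Z(Φ_k(X,Y)) − Φ_k([X,Y],Z) + Φ_k([X,Z],Y) − Φ_k([Y,Z],X) = 0, where X = g d/dx, Y = h d/dx, Z = l d/dx, λ = (1−k)/2, μ = (1+k)/2. -/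
open Polynomial

/-- The action `L^λ_{g d/dx}` of the vector field `g d/dx` on `λ`-densities `f dx^λ`:
`L^λ_{g d/dx}(f dx^λ) = (g f′ + λ g′ f) dx^λ`. -/
noncomputable def densityAct (lam : ℝ) (g f : Polynomial ℝ) : Polynomial ℝ :=
  g * derivative f + lam • (derivative g * f)

/-- The 2-cochain `Φ_k(g d/dx, h d/dx)(f dx^{(1−k)/2}) = (g′h″ − g″h′) f^{(k−1)} dx^{(1+k)/2}`. -/
noncomputable def Phi (k : ℕ) (g h f : Polynomial ℝ) : Polynomial ℝ :=
  (derivative g * derivative (derivative h) - derivative (derivative g) * derivative h)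
    * derivative^[k - 1] f

/-- The Lie bracket `[g d/dx, h d/dx] = (g h′ − g′ h) d/dx` of `vect(1)`. -/
noncomputable def vbr (g h : Polynomial ℝ) : Polynomial ℝ :=
  g * derivative h - derivative g * h

/-- The third derivative of a polynomial of degree at most two vanishes. -/
theorem derivative_three_eq_zero {g : Polynomial ℝ} (hg : g.degree ≤ 2) :
    derivative (derivative (derivative g)) = 0 := by
  have h : g.natDegree < 3 :=
    Nat.lt_succ_of_le (natDegree_le_iff_degree_le.mpr (by exact_mod_cast hg))
  simpa using iterate_derivative_eq_zero h

/-- Leibniz expansion of the iterated derivative of the action of a quadratic vector field; the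
coefficients of `g'` and `g''` do not depend on `g`. -/
theorem exists_iterate_derivative_densityAct (lam : ℝ) (f : Polynomial ℝ) (n : ℕ) :
    ∃ P Q : Polynomial ℝ, ∀ g : Polynomial ℝ, g.degree ≤ 2 →
      derivative^[n] (densityAct lam g f) =
        g * derivative (derivative^[n] f) + derivative g * P
          + derivative (derivative g) * Q := by
  induction n with
  | zero =>
    refine ⟨C lam * f, 0, fun g _ => ?_⟩
    simp only [densityAct, Function.iterate_zero, id_eq, smul_eq_C_mul]
    ring
  | succ n ih =>
    obtain ⟨P, Q, h⟩ := ih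
    refine ⟨derivative (derivative^[n] f) + derivative P, P + derivative Q, fun g hg => ?_⟩
    simp only [Function.iterate_succ_apply', h g hg, derivative_add, derivative_mul,
      derivative_three_eq_zero hg]
    ring

/-- For every `k ≥ 1`, `Φ_k` is a 2-cocycle of `sl(2)` with values in
`D_{(1−k)/2,(1+k)/2}`: for all `g, h, l` of degree `≤ 2` (with `X = g d/dx`, `Y = h d/dx`,
`Z = l d/dx`, `λ = (1−k)/2`, `μ = (1+k)/2`),
`L^{λ,μ}_X(Φ_k(Y,Z)) − L^{λ,μ}_Y(Φ_k(X,Z)) + L^{λ,μ}_Z(Φ_k(X,Y))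
  − Φ_k([X,Y],Z) + Φ_k([X,Z],Y) − Φ_k([Y,Z],X) = 0`. -/
theorem stmt3 (k : ℕ) (hk : 1 ≤ k) (g h l : Polynomial ℝ)
    (hg : g.degree ≤ 2) (hh : h.degree ≤ 2) (hl : l.degree ≤ 2) (f : Polynomial ℝ) :
    (densityAct ((1 + (k : ℝ)) / 2) g (Phi k h l f)
        - Phi k h l (densityAct ((1 - (k : ℝ)) / 2) g f))
      - (densityAct ((1 + (k : ℝ)) / 2) h (Phi k g l f)
        - Phi k g l (densityAct ((1 - (k : ℝ)) / 2) h f))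
      + (densityAct ((1 + (k : ℝ)) / 2) l (Phi k g h f)
        - Phi k g h (densityAct ((1 - (k : ℝ)) / 2) l f))
      - Phi k (vbr g h) l f + Phi k (vbr g l) h f - Phi k (vbr h l) g f = 0 := by
  obtain ⟨P, Q, hPQ⟩ := exists_iterate_derivative_densityAct ((1 - (k : ℝ)) / 2) f (k - 1)
  simp only [Phi, hPQ g hg, hPQ h hh, hPQ l hl]
  simp only [densityAct, vbr, smul_eq_C_mul, derivative_add, derivative_sub, derivative_mul,
    derivative_three_eq_zero hg, derivative_three_eq_zero hh, derivative_three_eq_zero hl]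
  ring
end

section
/- For every integer k ≥ 2 and all even polynomials F, G ∈ ℝ[x] of degree ≤ 2 (so X_F, X_G ∈ sl(2) ⊂ osp(1|2)), the operator Ω_k(X_F, X_G) on ℝ[x,θ] satisfies (−1)^k Ω_k(X_F, X_G) = (k−1)Φ_{k−1}(F d/dx, G d/dx) ∘ ∂_θ − k·θ·Φ_k(F d/dx, G d/dx); explicitly, for all f₀, f₁ ∈ ℝ[x]: (−1)^k Ω_k(X_F, X_G)(f₀ + θ f₁) = (k−1)(F′G″ − F″G′) f₁^{(k−2)} − k θ (F′G″ − F″G′) f₀^{(k−1)}. -/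
open Polynomial

/-- Superfunctions `F = f₀(x) + θ f₁(x)` on `ℝ^{1|1}`, encoded as the pair `(f₀, f₁)`. -/
abbrev SF : Type := Polynomial ℝ × Polynomial ℝ

/-- The even derivative `∂_x`. -/
noncomputable def sdx (W : SF) : SF := (derivative W.1, derivative W.2)

/-- The odd vector field `η̄ = ∂_θ − θ∂_x`: `η̄(f₀ + θf₁) = f₁ − θf₀′`. -/
noncomputable def etaB (W : SF) : SF := (W.2, -derivative W.1)

/-- The (super)product of superfunctions:
`(f₀ + θf₁)(w₀ + θw₁) = f₀w₀ + θ(f₀w₁ + f₁w₀)`. -/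
noncomputable def sprod (F W : SF) : SF := (F.1 * W.1, F.1 * W.2 + F.2 * W.1)

/-- `(−1)^p` for a parity `p`. -/
def sgn (p : Bool) : ℝ := if p then -1 else 1

/-- `(−1)^{pq}` for parities `p, q`. -/
def sgn2 (p q : Bool) : ℝ := if p && q then -1 else 1

/-- `F` is homogeneous of parity `pF`: even means `F = f₀(x)`, odd means `F = θ f₁(x)`. -/
def Homog (F : SF) (pF : Bool) : Prop :=
  (pF = false → F.2 = 0) ∧ (pF = true → F.1 = 0)

/-- `X_F` lies in `osp(1|2) = Span(X_1, X_θ, X_x, X_{xθ}, X_{x²})`: `F` is homogeneous of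
parity `pF`, with `F ∈ span{1, x, x²}` in the even case and `F ∈ θ·span{1, x}` in the odd case. -/
def OspHomog (F : SF) (pF : Bool) : Prop :=
  (pF = false → F.2 = 0 ∧ F.1.degree ≤ 2) ∧ (pF = true → F.1 = 0 ∧ F.2.degree ≤ 1)

/-- The contact vector field `X_F = F∂_x − ½(−1)^{p(F)} η̄(F)η̄` of a homogeneous
superfunction `F` of parity `pF`. -/
noncomputable def Xf (F : SF) (pF : Bool) (W : SF) : SF :=
  sprod F (sdx W) - (sgn pF * (1 / 2 : ℝ)) • sprod (etaB F) (etaB W)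

/-- The action of `X_F` (of parity `pF`) on `λ`-densities:
`𝔏^λ_{X_F}(W α^λ) = (X_F(W) + λ (∂_x F) W)α^λ`. -/
noncomputable def lden (lam : ℝ) (F : SF) (pF : Bool) (W : SF) : SF :=
  Xf F pF W + lam • sprod (sdx F) W

/-- The 2-cochain
`Ω_k(X_F, X_G) = (−1)^{p(F)+p(G)}(k−1)(F′G″ − F″G′)·η̄^{2k−3}
  + (η̄(F′)G′ − (−1)^{p(F)p(G)} F′η̄(G′))·η̄^{2k−2}`. -/
noncomputable def Om (k : ℕ) (F : SF) (pF : Bool) (G : SF) (pG : Bool) (W : SF) : SF :=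
  ((sgn pF * sgn pG) * ((k : ℝ) - 1)) •
      sprod (sprod (sdx F) (sdx (sdx G)) - sprod (sdx (sdx F)) (sdx G)) (etaB^[2 * k - 3] W)
    + sprod (sprod (etaB (sdx F)) (sdx G) - sgn2 pF pG • sprod (sdx F) (etaB (sdx G)))
        (etaB^[2 * k - 2] W)

theorem etaB_etaB (W : SF) : etaB (etaB W) = -sdx W := rfl

theorem etaB_iterate_two_mul (n : ℕ) (W : SF) :
    etaB^[2 * n] W =
      ((-1 : ℝ) ^ n • derivative^[n] W.1, (-1 : ℝ) ^ n • derivative^[n] W.2) := by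
  induction n with
  | zero => simp
  | succ n ih =>
    rw [show 2 * (n + 1) = 2 * n + 1 + 1 by ring, Function.iterate_succ_apply',
      Function.iterate_succ_apply', ih, etaB_etaB]
    simp [sdx, pow_succ, Function.iterate_succ_apply']

theorem etaB_iterate_two_mul_add_one (n : ℕ) (W : SF) :
    etaB^[2 * n + 1] W =
      ((-1 : ℝ) ^ n • derivative^[n] W.2, -((-1 : ℝ) ^ n • derivative^[n + 1] W.1)) := by
  rw [Function.iterate_succ_apply', etaB_iterate_two_mul]
  simp [etaB, Function.iterate_succ_apply']

/-- for every `k ≥ 2` and all even `F, G ∈ ℝ[x]` of degree ≤ 2 (so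
`X_F, X_G ∈ sl(2) ⊂ osp(1|2)`), the operator `Ω_k(X_F,X_G)` satisfies
`(−1)^k Ω_k(X_F, X_G) = (k−1)Φ_{k−1}(F d/dx, G d/dx) ∘ ∂_θ − k·θ·Φ_k(F d/dx, G d/dx)`,
i.e. for all `f₀, f₁ ∈ ℝ[x]`:
`(−1)^k Ω_k(X_F, X_G)(f₀ + θf₁)
  = (k−1)(F′G″ − F″G′) f₁^{(k−2)} − kθ(F′G″ − F″G′) f₀^{(k−1)}`. -/
theorem stmt14 (k : ℕ) (hk : 2 ≤ k) (F G : Polynomial ℝ)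
    (hF : F.degree ≤ 2) (hG : G.degree ≤ 2) (f₀ f₁ : Polynomial ℝ) :
    ((-1 : ℝ)) ^ k • Om k (F, 0) false (G, 0) false (f₀, f₁) =
      (((k : ℝ) - 1) •
          ((derivative F * derivative (derivative G)
              - derivative (derivative F) * derivative G) * derivative^[k - 2] f₁),
        -(k : ℝ) •
          ((derivative F * derivative (derivative G)
              - derivative (derivative F) * derivative G) * derivative^[k - 1] f₀)) := by
  obtain ⟨n, rfl⟩ := Nat.exists_eq_add_of_le' hk
  have hsq : (-1 : ℝ[X]) ^ n * (-1) ^ n = 1 := by simp [← mul_pow]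
  simp only [Om, show 2 * (n + 2) - 3 = 2 * n + 1 by omega,
    show 2 * (n + 2) - 2 = 2 * (n + 1) by omega, show n + 2 - 2 = n by omega,
    show n + 2 - 1 = n + 1 by omega, etaB_iterate_two_mul, etaB_iterate_two_mul_add_one]
  ext1
  · simp only [sprod, sdx, etaB, sgn, sgn2, smul_eq_C_mul, Prod.fst_add, Prod.smul_fst,
      Prod.fst_sub, derivative_zero, C_mul, C_pow]
    simp
    grind
  · simp only [sprod, sdx, etaB, sgn, sgn2, smul_eq_C_mul, Prod.snd_add, Prod.smul_snd,
      Prod.fst_sub, Prod.snd_sub, derivative_zero, C_mul, C_pow]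
    simp
    grind
end
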